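/- If S is a complete and clash-free constraint system generated by the optimised algorithm from {x₀ ⊨ φ}, then for every constraint x ⊨ ψ ∈ S, the canonical structure M_S satisfies M_S, x ⊨ ψ. -/

import Mathlib

/-! Core definitions for the graded modal logic Gr(K_R):
syntax, Kripke semantics, NNF, closure, constraint systems,
and the completion rules (optimised and standard). -/

namespace GrK

/-- Gr(K_R)-formulae over propositional atoms (ℕ) and relation names (ℕ).
`ge r n φ` is the counting modality ⟨R⟩_{≥n}φ and `le r n φ` is ⟨R⟩_{≤n}φ. -/
inductive GFormula : Type where
  | atom : ℕ → GFormula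
  | neg  : GFormula → GFormula
  | and  : GFormula → GFormula → GFormula
  | or   : GFormula → GFormula → GFormula
  | ge   : ℕ → ℕ → GFormula → GFormula
  | le   : ℕ → ℕ → GFormula → GFormula
  deriving DecidableEq

/-- A Kripke structure: a nonempty type of worlds, an accessibility relation
for each relation name, and a valuation. -/
structure Kripke where
  W : Type
  nonempty : Nonempty W
  rel : ℕ → W → W → Prop
  val : ℕ → Set W

/-- Satisfaction `M, x ⊨ φ`; the graded modalities count successors
(as a cardinal, to handle infinite structures faithfully). -/
def GFormula.sat (M : Kripke) : GFormula → M.W → Prop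
  | .atom p, x => x ∈ M.val p
  | .neg φ, x => ¬ GFormula.sat M φ x
  | .and φ ψ, x => GFormula.sat M φ x ∧ GFormula.sat M ψ x
  | .or φ ψ, x => GFormula.sat M φ x ∨ GFormula.sat M ψ x
  | .ge r n φ, x => (n : Cardinal) ≤ Cardinal.mk {y : M.W // M.rel r x y ∧ GFormula.sat M φ y}
  | .le r n φ, x => Cardinal.mk {y : M.W // M.rel r x y ∧ GFormula.sat M φ y} ≤ (n : Cardinal)

/-- ♯R^M(x,φ): the number of R-successors of x satisfying φ. -/
def Kripke.count (M : Kripke) (r : ℕ) (x : M.W) (φ : GFormula) : Cardinal :=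
  Cardinal.mk {y : M.W // M.rel r x y ∧ GFormula.sat M φ y}

/-- A formula is satisfiable iff it holds at some world of some Kripke structure. -/
def GFormula.satisfiable (φ : GFormula) : Prop :=
  ∃ (M : Kripke) (x : M.W), GFormula.sat M φ x

/-- Negation normal form: negation occurs only in front of atoms. -/
def GFormula.isNNF : GFormula → Prop
  | .atom _ => True
  | .neg (.atom _) => True
  | .neg _ => False
  | .and φ ψ => GFormula.isNNF φ ∧ GFormula.isNNF ψ
  | .or φ ψ => GFormula.isNNF φ ∧ GFormula.isNNF ψ
  | .ge _ _ φ => GFormula.isNNF φ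
  | .le _ _ φ => GFormula.isNNF φ

/-- ~φ : the NNF of the negation of an NNF formula. -/
def GFormula.nnfNeg : GFormula → GFormula
  | .atom p => .neg (.atom p)
  | .neg φ => φ
  | .and φ ψ => .or φ.nnfNeg ψ.nnfNeg
  | .or φ ψ => .and φ.nnfNeg ψ.nnfNeg
  | .ge r n φ => if n = 0 then .and (.atom 0) (.neg (.atom 0)) else .le r (n - 1) φ
  | .le r n φ => .ge r (n + 1) φ

/-- |φ| : the length of a formula. -/
def GFormula.size : GFormula → ℕ
  | .atom _ => 1
  | .neg φ => 1 + φ.size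
  | .and φ ψ => 1 + φ.size + ψ.size
  | .or φ ψ => 1 + φ.size + ψ.size
  | .ge _ _ φ => 1 + φ.size
  | .le _ _ φ => 1 + φ.size

/-- sub(φ) : the set of subformulae of φ. -/
def GFormula.sub : GFormula → Finset GFormula
  | .atom p => {.atom p}
  | .neg φ => insert (.neg φ) φ.sub
  | .and φ ψ => insert (.and φ ψ) (φ.sub ∪ ψ.sub)
  | .or φ ψ => insert (.or φ ψ) (φ.sub ∪ ψ.sub)
  | .ge r n φ => insert (.ge r n φ) φ.sub
  | .le r n φ => insert (.le r n φ) φ.sub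

/-- Membership in clos(φ): the smallest set containing φ, closed under
immediate subformulae of ∧, ∨ and the graded modalities, and closed under ~. -/
inductive InClos (φ : GFormula) : GFormula → Prop
  | base : InClos φ φ
  | andL {ψ₁ ψ₂} : InClos φ (.and ψ₁ ψ₂) → InClos φ ψ₁
  | andR {ψ₁ ψ₂} : InClos φ (.and ψ₁ ψ₂) → InClos φ ψ₂
  | orL {ψ₁ ψ₂} : InClos φ (.or ψ₁ ψ₂) → InClos φ ψ₁
  | orR {ψ₁ ψ₂} : InClos φ (.or ψ₁ ψ₂) → InClos φ ψ₂
  | ge {r n ψ} : InClos φ (.ge r n ψ) → InClos φ ψ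
  | le {r n ψ} : InClos φ (.le r n ψ) → InClos φ ψ
  | nnfNeg {ψ} : InClos φ ψ → InClos φ ψ.nnfNeg

/-- clos(φ) as a set of formulae. -/
def clos (φ : GFormula) : Set GFormula := {ψ | InClos φ ψ}

/-- A constraint: either `x ⊨ ψ` or `R x y`;
a constraint system (c.s.) is a finite set of constraints. -/
inductive Constraint : Type where
  | sat : ℕ → GFormula → Constraint
  | rel : ℕ → ℕ → ℕ → Constraint
  deriving DecidableEq

/-- The variables occurring in a constraint. -/
def Constraint.vars : Constraint → Finset ℕ
  | .sat x _ => {x}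
  | .rel _ x y => {x, y}

/-- ♯R^S(x,ψ): the number of variables y with {Rxy, y ⊨ ψ} ⊆ S. -/
noncomputable def countS (S : Finset Constraint) (r x : ℕ) (ψ : GFormula) : ℕ :=
  Set.ncard {y : ℕ | Constraint.rel r x y ∈ S ∧ Constraint.sat y ψ ∈ S}

/-- A clash: {x ⊨ p, x ⊨ ¬p} ⊆ S, or x ⊨ ⟨R⟩_{≤n}ψ ∈ S with ♯R^S(x,ψ) > n. -/
def hasClash (S : Finset Constraint) : Prop :=
  (∃ x p, Constraint.sat x (.atom p) ∈ S ∧ Constraint.sat x (.neg (.atom p)) ∈ S) ∨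
  (∃ x r n ψ, Constraint.sat x (.le r n ψ) ∈ S ∧ n < countS S r x ψ)

/-- `y` is a fresh variable w.r.t. S. -/
def freshIn (y : ℕ) (S : Finset Constraint) : Prop := ∀ c ∈ S, y ∉ c.vars

/-- The →∧-rule is applicable to a constraint for x in S. -/
def andApplicable (S : Finset Constraint) (x : ℕ) : Prop :=
  ∃ ψ₁ ψ₂, Constraint.sat x (.and ψ₁ ψ₂) ∈ S ∧
    ¬ (Constraint.sat x ψ₁ ∈ S ∧ Constraint.sat x ψ₂ ∈ S)

/-- The →∨-rule is applicable to a constraint for x in S. -/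
def orApplicable (S : Finset Constraint) (x : ℕ) : Prop :=
  ∃ ψ₁ ψ₂, Constraint.sat x (.or ψ₁ ψ₂) ∈ S ∧
    Constraint.sat x ψ₁ ∉ S ∧ Constraint.sat x ψ₂ ∉ S

/-- One application of the →∧-rule. -/
inductive StepAnd : Finset Constraint → Finset Constraint → Prop
  | mk (S : Finset Constraint) (x : ℕ) (ψ₁ ψ₂ : GFormula)
      (h : Constraint.sat x (.and ψ₁ ψ₂) ∈ S)
      (h2 : ¬ (Constraint.sat x ψ₁ ∈ S ∧ Constraint.sat x ψ₂ ∈ S)) :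
      StepAnd S (insert (Constraint.sat x ψ₁) (insert (Constraint.sat x ψ₂) S))

/-- One application of the →∨-rule. -/
inductive StepOr : Finset Constraint → Finset Constraint → Prop
  | mk (S : Finset Constraint) (x : ℕ) (ψ₁ ψ₂ χ : GFormula)
      (h : Constraint.sat x (.or ψ₁ ψ₂) ∈ S)
      (h1 : Constraint.sat x ψ₁ ∉ S) (h2 : Constraint.sat x ψ₂ ∉ S)
      (hχ : χ = ψ₁ ∨ χ = ψ₂) :
      StepOr S (insert (Constraint.sat x χ) S)

/-- One application of the optimised →≥-rule: if x ⊨ ⟨R⟩_{≥n}ψ ∈ S,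
♯R^S(x,ψ) < n and no →∧/→∨ rule applies to a constraint for x, add (for a
fresh y) the constraints Rxy, y ⊨ ψ, and y ⊨ χᵢ with χᵢ ∈ {ψᵢ, ~ψᵢ} for every
ψᵢ occurring in a graded constraint ⟨R⟩_{⋈m}ψᵢ for x with the same relation R. -/
inductive StepGe : Finset Constraint → Finset Constraint → Prop
  | mk (S S' : Finset Constraint) (x r n : ℕ) (ψ : GFormula) (y : ℕ)
      (f : GFormula → GFormula)
      (h : Constraint.sat x (.ge r n ψ) ∈ S)
      (hc : countS S r x ψ < n)
      (hna : ¬ andApplicable S x) (hno : ¬ orApplicable S x)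
      (hy : freshIn y S)
      (hf : ∀ ψ', f ψ' = ψ' ∨ f ψ' = ψ'.nnfNeg)
      (hS' : (S' : Set Constraint) = (S : Set Constraint) ∪
          {Constraint.rel r x y, Constraint.sat y ψ} ∪
          {c | ∃ ψ' m,
            (Constraint.sat x (.ge r m ψ') ∈ S ∨ Constraint.sat x (.le r m ψ') ∈ S) ∧
            c = Constraint.sat y (f ψ')}) :
      StepGe S S'

/-- One application of any optimised completion rule. -/
def OptStep (S S' : Finset Constraint) : Prop := StepAnd S S' ∨ StepOr S S' ∨ StepGe S S'

/-- The initial constraint system {x₀ ⊨ φ}. -/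
def initCS (x₀ : ℕ) (φ : GFormula) : Finset Constraint := {Constraint.sat x₀ φ}

/-- S is obtained from {x₀ ⊨ φ} by a sequence of optimised rule applications. -/
def OptReach (x₀ : ℕ) (φ : GFormula) (S : Finset Constraint) : Prop :=
  Relation.ReflTransGen OptStep (initCS x₀ φ) S

/-- A c.s. is complete iff no optimised rule is applicable. -/
def OptComplete (S : Finset Constraint) : Prop := ¬ ∃ S', OptStep S S'

/-- The edges of the graph G(S) induced by a c.s. S. -/
def edge (S : Finset Constraint) (x y : ℕ) : Prop := ∃ r, Constraint.rel r x y ∈ S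

/-- The variable x occurs in S (x is a node of G(S)). -/
def occursIn (x : ℕ) (S : Finset Constraint) : Prop := ∃ c ∈ S, x ∈ c.vars

/-- Satisfiability of a constraint system. -/
def csSat (S : Finset Constraint) : Prop :=
  ∃ (M : Kripke) (α : ℕ → M.W),
    (∀ r x y z, Constraint.rel r x y ∈ S → Constraint.rel r x z ∈ S → y ≠ z → α y ≠ α z) ∧
    (∀ x ψ, Constraint.sat x ψ ∈ S → GFormula.sat M ψ (α x)) ∧
    (∀ r x y, Constraint.rel r x y ∈ S → M.rel r (α x) (α y))

/-- The canonical structure M_S induced by a c.s. S (on the variables,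
with accessibility and valuation read off from S). -/
def canonical (S : Finset Constraint) : Kripke where
  W := ℕ
  nonempty := ⟨0⟩
  rel := fun r x y => Constraint.rel r x y ∈ S
  val := fun p => {x | Constraint.sat x (.atom p) ∈ S}

/-- Renaming a variable: `rename y z c` replaces y by z in the constraint c. -/
def Constraint.rename (y z : ℕ) : Constraint → Constraint
  | .sat x ψ => .sat (if x = y then z else x) ψ
  | .rel r a b => .rel r (if a = y then z else a) (if b = y then z else b)

/-- [z/y]S : replace every occurrence of y by z in S. -/
def renameCS (S : Finset Constraint) (y z : ℕ) : Finset Constraint :=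
  S.image (Constraint.rename y z)

/-- The replacement of y by z in S is safe. -/
def safeReplace (S : Finset Constraint) (y z : ℕ) : Prop :=
  ∀ x r n ψ, Constraint.sat x (.ge r n ψ) ∈ S → Constraint.rel r x y ∈ S →
    Constraint.rel r x z ∈ S → n ≤ countS (renameCS S y z) r x ψ

/-- One application of a standard (Hollunder–Baader) completion rule. -/
inductive StdStep : Finset Constraint → Finset Constraint → Prop
  | and (S : Finset Constraint) (x : ℕ) (ψ₁ ψ₂ : GFormula)
      (h : Constraint.sat x (.and ψ₁ ψ₂) ∈ S)
      (h2 : ¬ (Constraint.sat x ψ₁ ∈ S ∧ Constraint.sat x ψ₂ ∈ S)) :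
      StdStep S (insert (Constraint.sat x ψ₁) (insert (Constraint.sat x ψ₂) S))
  | or (S : Finset Constraint) (x : ℕ) (ψ₁ ψ₂ χ : GFormula)
      (h : Constraint.sat x (.or ψ₁ ψ₂) ∈ S)
      (h1 : Constraint.sat x ψ₁ ∉ S) (h2 : Constraint.sat x ψ₂ ∉ S)
      (hχ : χ = ψ₁ ∨ χ = ψ₂) :
      StdStep S (insert (Constraint.sat x χ) S)
  | choose (S : Finset Constraint) (x r n : ℕ) (ψ χ : GFormula) (y : ℕ)
      (h : Constraint.sat x (.ge r n ψ) ∈ S ∨ Constraint.sat x (.le r n ψ) ∈ S)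
      (hr : Constraint.rel r x y ∈ S)
      (h1 : Constraint.sat y ψ ∉ S) (h2 : Constraint.sat y ψ.nnfNeg ∉ S)
      (hχ : χ = ψ ∨ χ = ψ.nnfNeg) :
      StdStep S (insert (Constraint.sat y χ) S)
  | ge (S : Finset Constraint) (x r n : ℕ) (ψ : GFormula) (y : ℕ)
      (h : Constraint.sat x (.ge r n ψ) ∈ S)
      (hc : countS S r x ψ < n)
      (hy : freshIn y S) :
      StdStep S (insert (Constraint.rel r x y) (insert (Constraint.sat y ψ) S))
  | le (S : Finset Constraint) (x r n : ℕ) (ψ : GFormula) (y z : ℕ)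
      (h : Constraint.sat x (.le r n ψ) ∈ S)
      (hc : n < countS S r x ψ)
      (hyz : y ≠ z)
      (h1 : Constraint.rel r x y ∈ S) (h2 : Constraint.rel r x z ∈ S)
      (h3 : Constraint.sat y ψ ∈ S) (h4 : Constraint.sat z ψ ∈ S)
      (hsafe : safeReplace S y z) :
      StdStep S (renameCS S y z)

/-- S is obtained from {x₀ ⊨ φ} by a sequence of standard rule applications. -/
def StdReach (x₀ : ℕ) (φ : GFormula) (S : Finset Constraint) : Prop :=
  Relation.ReflTransGen StdStep (initCS x₀ φ) S

/-- A c.s. is complete (for the standard rules) iff no rule is applicable. -/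
def StdComplete (S : Finset Constraint) : Prop := ¬ ∃ S', StdStep S S'

end GrK

namespace GrK

/-- Auxiliary weight, not increased by `nnfNeg`. -/
def GFormula.wt : GFormula → ℕ
  | .atom _ => 1
  | .neg φ => φ.wt
  | .and φ ψ => 1 + φ.wt + ψ.wt
  | .or φ ψ => 1 + φ.wt + ψ.wt
  | .ge _ _ φ => 10 + φ.wt
  | .le _ _ φ => 10 + φ.wt

lemma wt_nnfNeg (φ : GFormula) : φ.nnfNeg.wt ≤ φ.wt := by
  induction φ with
  | atom p => simp [GFormula.nnfNeg, GFormula.wt]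
  | neg φ _ => simp [GFormula.nnfNeg, GFormula.wt]
  | and φ ψ h1 h2 => simp only [GFormula.nnfNeg, GFormula.wt]; omega
  | or φ ψ h1 h2 => simp only [GFormula.nnfNeg, GFormula.wt]; omega
  | ge r n φ _ =>
    simp only [GFormula.nnfNeg]
    split_ifs <;> simp only [GFormula.wt] <;> omega
  | le r n φ _ => simp [GFormula.nnfNeg, GFormula.wt]

lemma nnf_nnfNeg (φ : GFormula) (h : φ.isNNF) : φ.nnfNeg.isNNF := by
  induction φ with
  | atom p => simp [GFormula.nnfNeg, GFormula.isNNF]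
  | neg φ _ => cases φ <;> simp_all [GFormula.nnfNeg, GFormula.isNNF]
  | and φ ψ h1 h2 => simp_all [GFormula.nnfNeg, GFormula.isNNF]
  | or φ ψ h1 h2 => simp_all [GFormula.nnfNeg, GFormula.isNNF]
  | ge r n φ _ =>
    simp only [GFormula.nnfNeg]
    split_ifs <;> simp_all [GFormula.isNNF]
  | le r n φ _ => simp_all [GFormula.nnfNeg, GFormula.isNNF]

lemma sat_nnfNeg (M : Kripke) (φ : GFormula) (x : M.W) (h : φ.nnfNeg.sat M x) :
    ¬ φ.sat M x := by
  induction φ generalizing x with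
  | atom p => exact h
  | neg φ _ => exact fun h' => h' h
  | and φ ψ h1 h2 =>
    rintro ⟨a, b⟩
    rcases h with h | h
    · exact h1 x h a
    · exact h2 x h b
  | or φ ψ h1 h2 =>
    rintro (a | a)
    · exact h1 x h.1 a
    · exact h2 x h.2 a
  | ge r n φ _ =>
    intro h'
    simp only [GFormula.nnfNeg] at h
    split_ifs at h with hn
    · exact h.2 h.1
    · have h3 : (n : Cardinal) ≤ ((n - 1 : ℕ) : Cardinal) := le_trans h' h
      have := Nat.cast_le.1 h3
      omega
  | le r n φ _ =>
    intro h'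
    have h3 : ((n + 1 : ℕ) : Cardinal) ≤ (n : Cardinal) := le_trans h h'
    have := Nat.cast_le.1 h3
    omega

/-- Invariant of the optimised algorithm. -/
def Inv (S : Finset Constraint) : Prop :=
  (∀ x ψ, Constraint.sat x ψ ∈ S → ψ.isNNF) ∧
  ∀ r x y, Constraint.rel r x y ∈ S → ¬ andApplicable S x ∧ ¬ orApplicable S x ∧
    ∀ m ψ, (Constraint.sat x (.ge r m ψ) ∈ S ∨ Constraint.sat x (.le r m ψ) ∈ S) →
      Constraint.sat y ψ ∈ S ∨ Constraint.sat y ψ.nnfNeg ∈ S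

/-- Transfer of the local part when the constraints for x do not change. -/
lemma local_transfer {S S' : Finset Constraint} (hsub : S ⊆ S') {r x y : ℕ}
    (hx : ∀ ψ, Constraint.sat x ψ ∈ S' → Constraint.sat x ψ ∈ S)
    (h : ¬ andApplicable S x ∧ ¬ orApplicable S x ∧
      ∀ m ψ, (Constraint.sat x (.ge r m ψ) ∈ S ∨ Constraint.sat x (.le r m ψ) ∈ S) →
        Constraint.sat y ψ ∈ S ∨ Constraint.sat y ψ.nnfNeg ∈ S) :
    ¬ andApplicable S' x ∧ ¬ orApplicable S' x ∧
      ∀ m ψ, (Constraint.sat x (.ge r m ψ) ∈ S' ∨ Constraint.sat x (.le r m ψ) ∈ S') →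
        Constraint.sat y ψ ∈ S' ∨ Constraint.sat y ψ.nnfNeg ∈ S' := by
  obtain ⟨h1, h2, h3⟩ := h
  refine ⟨?_, ?_, ?_⟩
  · rintro ⟨a, b, h, h'⟩
    exact h1 ⟨a, b, hx _ h, fun hh => h' ⟨hsub hh.1, hsub hh.2⟩⟩
  · rintro ⟨a, b, h, ha, hb⟩
    exact h2 ⟨a, b, hx _ h, fun hh => ha (hsub hh), fun hh => hb (hsub hh)⟩
  · intro m ψ h
    exact (h3 m ψ (h.imp (hx _) (hx _))).imp (fun h => hsub h) (fun h => hsub h)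

lemma inv_step {S S' : Finset Constraint} (hI : Inv S) (h : OptStep S S') : Inv S' := by
  obtain ⟨hN, hR⟩ := hI
  rcases h with h | h | h
  · obtain ⟨x, ψ₁, ψ₂, h, h2⟩ := h
    have hn := hN _ _ h
    simp only [GFormula.isNNF] at hn
    refine ⟨?_, ?_⟩
    · intro z χ hz
      simp only [Finset.mem_insert, Constraint.sat.injEq] at hz
      rcases hz with ⟨_, rfl⟩ | ⟨_, rfl⟩ | hz
      exacts [hn.1, hn.2, hN _ _ hz]
    · intro r z y hz
      simp only [Finset.mem_insert, reduceCtorEq, false_or] at hz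
      have hl := hR r z y hz
      refine local_transfer (fun c hc => by simp [hc]) ?_ hl
      have hzx : z ≠ x := by
        rintro rfl
        exact hl.1 ⟨_, _, h, h2⟩
      intro χ hχ
      simpa [hzx] using hχ
  · obtain ⟨x, ψ₁, ψ₂, χ, h, h1, h2, hχ⟩ := h
    have hn := hN _ _ h
    simp only [GFormula.isNNF] at hn
    refine ⟨?_, ?_⟩
    · intro z χ' hz
      simp only [Finset.mem_insert, Constraint.sat.injEq] at hz
      rcases hz with ⟨_, rfl⟩ | hz
      · rcases hχ with rfl | rfl
        exacts [hn.1, hn.2]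
      · exact hN _ _ hz
    · intro r z y hz
      simp only [Finset.mem_insert, reduceCtorEq, false_or] at hz
      have hl := hR r z y hz
      refine local_transfer (fun c hc => by simp [hc]) ?_ hl
      have hzx : z ≠ x := by
        rintro rfl
        exact hl.2.1 ⟨_, _, h, h1, h2⟩
      intro χ hχ
      simpa [hzx] using hχ
  · obtain ⟨x, r, n, ψ, y, f, h, hc, hna, hno, hy, hf, hS'⟩ := h
    have hmem : ∀ c, c ∈ S' ↔ (c ∈ S ∨ (c = Constraint.rel r x y ∨ c = Constraint.sat y ψ)) ∨
        ∃ ψ' m, (Constraint.sat x (.ge r m ψ') ∈ S ∨ Constraint.sat x (.le r m ψ') ∈ S) ∧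
            c = Constraint.sat y (f ψ') := by
      intro c
      have := Set.ext_iff.1 hS' c
      exact this
    have hsub : S ⊆ S' := fun c hc => (hmem c).2 (Or.inl (Or.inl hc))
    have hold : ∀ z, z ≠ y → ∀ χ, Constraint.sat z χ ∈ S' → Constraint.sat z χ ∈ S := by
      intro z hz χ hχ
      rw [hmem] at hχ
      simpa [hz] using hχ
    have hxy : x ≠ y := by
      rintro rfl
      exact hy _ h (by simp [Constraint.vars])
    refine ⟨?_, ?_⟩
    · intro z χ hz
      rw [hmem] at hz
      rcases hz with (hz | hz | hz) | ⟨ψ', m, h', hz⟩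
      · exact hN _ _ hz
      · cases hz
      · cases hz
        exact (show (GFormula.ge r n ψ).isNNF from hN _ _ h)
      · cases hz
        have hn : ψ'.isNNF := by
          rcases h' with h' | h'
          · exact (show (GFormula.ge r m ψ').isNNF from hN _ _ h')
          · exact (show (GFormula.le r m ψ').isNNF from hN _ _ h')
        rcases hf ψ' with e | e <;> rw [e]
        · exact hn
        · exact nnf_nnfNeg _ hn
    · intro r' z w hz
      rw [hmem] at hz
      have hz2 : Constraint.rel r' z w ∈ S ∨ (r' = r ∧ z = x ∧ w = y) := by
        simpa using hz
      clear hz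
      rcases hz2 with hz | ⟨rfl, rfl, rfl⟩
      · refine local_transfer hsub (hold z ?_) (hR _ _ _ hz)
        rintro rfl
        exact hy _ hz (by simp [Constraint.vars])
      · refine ⟨?_, ?_, ?_⟩
        · rintro ⟨a, b, h, h'⟩
          exact hna ⟨a, b, hold _ hxy _ h, fun hh => h' ⟨hsub hh.1, hsub hh.2⟩⟩
        · rintro ⟨a, b, h, ha, hb⟩
          exact hno ⟨a, b, hold _ hxy _ h, fun hh => ha (hsub hh), fun hh => hb (hsub hh)⟩
        · intro m χ hχ
          have hm := (hmem (Constraint.sat w (f χ))).2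
            (Or.inr ⟨χ, m, hχ.imp (hold _ hxy _) (hold _ hxy _), rfl⟩)
          rcases hf χ with e | e <;> rw [e] at hm
          · exact Or.inl hm
          · exact Or.inr hm

lemma inv_reach {x₀ : ℕ} {φ : GFormula} (hφ : φ.isNNF) {S : Finset Constraint}
    (h : OptReach x₀ φ S) : Inv S := by
  induction h with
  | refl =>
    refine ⟨?_, ?_⟩
    · intro x ψ h
      simp only [initCS, Finset.mem_singleton, Constraint.sat.injEq] at h
      rw [h.2]
      exact hφ
    · intro r x y h
      simp [initCS] at h
  | tail _ h ih => exact inv_step ih h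

lemma exists_fresh (S : Finset Constraint) : ∃ y, freshIn y S := by
  obtain ⟨y, hy⟩ := Infinite.exists_notMem_finset (S.biUnion Constraint.vars)
  exact ⟨y, fun c hc hm => hy (Finset.mem_biUnion.2 ⟨c, hc, hm⟩)⟩

lemma ge_count {S : Finset Constraint} (hcomp : OptComplete S) {x r n : ℕ} {ψ : GFormula}
    (h : Constraint.sat x (.ge r n ψ) ∈ S) : n ≤ countS S r x ψ := by
  by_contra hc
  push Not at hc
  obtain ⟨y, hy⟩ := exists_fresh S
  have hna : ¬ andApplicable S x := fun ⟨a, b, h1, h2⟩ =>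
    hcomp ⟨_, Or.inl (StepAnd.mk S x a b h1 h2)⟩
  have hno : ¬ orApplicable S x := fun ⟨a, b, h1, h2, h3⟩ =>
    hcomp ⟨_, Or.inr (Or.inl (StepOr.mk S x a b a h1 h2 h3 (Or.inl rfl)))⟩
  have hfin : ((S : Set Constraint) ∪
          {Constraint.rel r x y, Constraint.sat y ψ} ∪
          {c | ∃ ψ' m,
            (Constraint.sat x (.ge r m ψ') ∈ S ∨ Constraint.sat x (.le r m ψ') ∈ S) ∧
            c = Constraint.sat y (id ψ')}).Finite := by
    refine (S.finite_toSet.union (by simp)).union ?_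
    let g : Constraint → Constraint := fun c => match c with
      | .sat _ (.ge _ _ χ) => .sat y χ
      | .sat _ (.le _ _ χ) => .sat y χ
      | c => c
    refine (S.finite_toSet.image g).subset ?_
    rintro c ⟨χ, m, h | h, rfl⟩
    · exact ⟨_, h, rfl⟩
    · exact ⟨_, h, rfl⟩
  exact hcomp ⟨hfin.toFinset, Or.inr (Or.inr (StepGe.mk S _ x r n ψ y id h hc hna hno hy
    (fun _ => Or.inl rfl) hfin.coe_toFinset))⟩

lemma succ_finite (S : Finset Constraint) (r x : ℕ) (ψ : GFormula) :
    {y : ℕ | Constraint.rel r x y ∈ S ∧ Constraint.sat y ψ ∈ S}.Finite := by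
  refine (S.biUnion Constraint.vars).finite_toSet.subset ?_
  rintro y ⟨h, -⟩
  exact Finset.mem_biUnion.2 ⟨_, h, by simp [Constraint.vars]⟩

lemma countS_eq (S : Finset Constraint) (r x : ℕ) (ψ : GFormula) :
    (countS S r x ψ : Cardinal) =
      Cardinal.mk {y : ℕ | Constraint.rel r x y ∈ S ∧ Constraint.sat y ψ ∈ S} :=
  Set.cast_ncard (succ_finite S r x ψ)

lemma main_aux {S : Finset Constraint} (hI : Inv S) (hcomp : OptComplete S)
    (hcf : ¬ hasClash S) (k : ℕ) : ∀ x ψ, GFormula.wt ψ ≤ k → Constraint.sat x ψ ∈ S →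
      GFormula.sat (canonical S) ψ x := by
  induction k with
  | zero =>
    intro x ψ hk h
    exfalso
    have : ∀ χ : GFormula, 0 < χ.wt := by
      intro χ
      induction χ <;> simp only [GFormula.wt] <;> omega
    have := this ψ
    omega
  | succ k ih =>
    intro x ψ hk h
    cases ψ with
    | atom p => exact h
    | neg χ =>
      have hn := hI.1 _ _ h
      cases χ <;> simp only [GFormula.isNNF] at hn
      exact fun h' => hcf (Or.inl ⟨_, _, h', h⟩)
    | and a b =>
      simp only [GFormula.wt] at hk
      have hh : Constraint.sat x a ∈ S ∧ Constraint.sat x b ∈ S := by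
        by_contra h2
        exact hcomp ⟨_, Or.inl (StepAnd.mk S x a b h h2)⟩
      exact ⟨ih _ _ (by omega) hh.1, ih _ _ (by omega) hh.2⟩
    | or a b =>
      simp only [GFormula.wt] at hk
      by_cases h1 : Constraint.sat x a ∈ S
      · exact Or.inl (ih _ _ (by omega) h1)
      by_cases h2 : Constraint.sat x b ∈ S
      · exact Or.inr (ih _ _ (by omega) h2)
      exact (hcomp ⟨_, Or.inr (Or.inl (StepOr.mk S x a b a h h1 h2 (Or.inl rfl)))⟩).elim
    | ge r n χ =>
      simp only [GFormula.wt] at hk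
      have h1 : (n : Cardinal) ≤ countS S r x χ := Nat.cast_le.2 (ge_count hcomp h)
      rw [countS_eq] at h1
      refine h1.trans ?_
      exact Cardinal.mk_le_mk_of_subset (α := ℕ)
        (t := {y : ℕ | Constraint.rel r x y ∈ S ∧ GFormula.sat (canonical S) χ y})
        (fun y hy => ⟨hy.1, ih _ _ (by omega) hy.2⟩)
    | le r n χ =>
      simp only [GFormula.wt] at hk
      have h0 : countS S r x χ ≤ n := by
        by_contra hc
        exact hcf (Or.inr ⟨_, _, _, _, h, by omega⟩)
      have h1 : (countS S r x χ : Cardinal) ≤ n := Nat.cast_le.2 h0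
      rw [countS_eq] at h1
      refine le_trans ?_ h1
      refine Cardinal.mk_le_mk_of_subset (α := ℕ)
        (s := {y : ℕ | Constraint.rel r x y ∈ S ∧ GFormula.sat (canonical S) χ y}) ?_
      rintro y ⟨hr, hs⟩
      refine ⟨hr, ?_⟩
      rcases (hI.2 _ _ _ hr).2.2 n χ (Or.inr h) with h' | h'
      · exact h'
      · have := wt_nnfNeg χ
        exact (sat_nnfNeg _ _ _ (ih _ _ (by omega) h') hs).elim

end GrK

open GrK in
/-- if S is a complete and clash-free c.s. generated by the
optimised algorithm from {x₀ ⊨ φ}, then for every constraint x ⊨ ψ ∈ S the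
canonical structure M_S satisfies M_S, x ⊨ ψ. -/
theorem stmt_12 (φ : GFormula) (hNNF : φ.isNNF) (x₀ : ℕ) (S : Finset Constraint)
    (hreach : OptReach x₀ φ S) (hcomp : OptComplete S) (hcf : ¬ hasClash S) :
    ∀ x ψ, Constraint.sat x ψ ∈ S → GFormula.sat (canonical S) ψ x := by
  exact fun x ψ h => main_aux (inv_reach hNNF hreach) hcomp hcf _ x ψ le_rfl h
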